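/- Let F be a field, m, n ≥ 1 and ε, η ≥ 0, and let λM_1 + M_0 be any pencil of size (η+1)m × (ε+1)n over F. Then the (ε,n,η,m)-block Kronecker pencil L(λ) = [[λM_1+M_0, L_η(λ)ᵀ⊗I_m],[L_ε(λ)⊗I_n, 0]] is a strong linearization of the m×n matrix polynomial Q(λ) := (Λ_η(λ)ᵀ⊗I_m)(λM_1+M_0)(Λ_ε(λ)⊗I_n), regarded as a polynomial of grade ε+η+1; that is, there exist unimodular matrix polynomials U(λ), V(λ) with U(λ)L(λ)V(λ) = diag(I_{εn+ηm}, Q(λ)), and likewise rev_1 L(λ) := λL(1/λ) is a linearization of rev_{ε+η+1} Q(λ) := λ^{ε+η+1}Q(1/λ). -/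

import Mathlib

open Polynomial Matrix
open scoped Kronecker

/-- The `k×(k+1)` pencil `L_k(λ)` with `-1` on the main diagonal and `λ` on the superdiagonal. -/
noncomputable def Lk (R : Type*) [CommRing R] (k : ℕ) :
    Matrix (Fin k) (Fin (k + 1)) (Polynomial R) :=
  Matrix.of fun i j =>
    if (j : ℕ) = (i : ℕ) then -1 else if (j : ℕ) = (i : ℕ) + 1 then Polynomial.X else 0

/-- The `(k+1)×1` vector polynomial `Λ_k(λ) = (λ^k, λ^{k-1}, …, λ, 1)ᵀ`. -/
noncomputable def Lam (R : Type*) [CommRing R] (k : ℕ) :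
    Matrix (Fin (k + 1)) (Fin 1) (Polynomial R) :=
  Matrix.of fun i _ => Polynomial.X ^ (k - (i : ℕ))

/-- The `(ε,n,η,m)`-block Kronecker pencil
`L(λ) = [[λM₁+M₀, L_η(λ)ᵀ⊗I_m],[L_ε(λ)⊗I_n, 0]]`, whose `(1,1)` block is the pencil `M`. -/
noncomputable def blockKron (R : Type*) [CommRing R] (ε n η m : ℕ)
    (M : Matrix (Fin (η + 1) × Fin m) (Fin (ε + 1) × Fin n) (Polynomial R)) :
    Matrix ((Fin (η + 1) × Fin m) ⊕ (Fin ε × Fin n))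
      ((Fin (ε + 1) × Fin n) ⊕ (Fin η × Fin m)) (Polynomial R) :=
  Matrix.fromBlocks M
    ((Lk R η).transpose ⊗ₖ (1 : Matrix (Fin m) (Fin m) (Polynomial R)))
    ((Lk R ε) ⊗ₖ (1 : Matrix (Fin n) (Fin n) (Polynomial R))) 0

/-- `Q(λ) := (Λ_η(λ)ᵀ⊗I_m)·(λM₁+M₀)·(Λ_ε(λ)⊗I_n)`, the `m×n` matrix polynomial associated
with the `(1,1)` block `M` of a block Kronecker pencil. -/
noncomputable def QpolyOf (R : Type*) [CommRing R] (ε n η m : ℕ)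
    (M : Matrix (Fin (η + 1) × Fin m) (Fin (ε + 1) × Fin n) (Polynomial R)) :
    Matrix (Fin 1 × Fin m) (Fin 1 × Fin n) (Polynomial R) :=
  ((Lam R η).transpose ⊗ₖ (1 : Matrix (Fin m) (Fin m) (Polynomial R))) * M *
    ((Lam R ε) ⊗ₖ (1 : Matrix (Fin n) (Fin n) (Polynomial R)))

/-- `L` is a linearization of `P` with identity block of size `s`: there are unimodular
matrix polynomials `U, V` with `U·L·V = diag(I_s, P)` (up to a bijective relabelling of the
row and column indices of `L`). -/
def IsLinearizationWith {F : Type*} [Field F] {R C ι κ : Type*}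
    [Fintype R] [Fintype C] [DecidableEq R] [DecidableEq C]
    (s : ℕ) (L : Matrix R C (Polynomial F)) (P : Matrix ι κ (Polynomial F)) : Prop :=
  ∃ (er : R ≃ (Fin s ⊕ ι)) (ec : C ≃ (Fin s ⊕ κ))
    (U : Matrix R R (Polynomial F)) (V : Matrix C C (Polynomial F)),
    IsUnit U.det ∧ IsUnit V.det ∧
    (U * L * V).submatrix er.symm ec.symm = Matrix.fromBlocks 1 0 0 P

/-- `L` is a linearization of `P`: `U·L·V = diag(I_s, P)` for some `s ≥ 0` and
unimodular `U, V`. -/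
def IsLinearization {F : Type*} [Field F] {R C ι κ : Type*}
    [Fintype R] [Fintype C] [DecidableEq R] [DecidableEq C]
    (L : Matrix R C (Polynomial F)) (P : Matrix ι κ (Polynomial F)) : Prop :=
  ∃ s : ℕ, IsLinearizationWith s L P

/-- The grade-`d` reversal `rev_d P(λ) := λ^d·P(1/λ)` of a matrix polynomial,
computed entrywise by `Polynomial.reflect`. -/
noncomputable def revMat {R : Type*} [CommRing R] {ι κ : Type*} (d : ℕ)
    (P : Matrix ι κ (Polynomial R)) : Matrix ι κ (Polynomial R) :=
  Matrix.of fun i j => (P i j).reflect d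

theorem lin_abstract {F : Type*} [Field F] {r c e h ι κ : Type*}
    [Fintype r] [Fintype c] [Fintype e] [Fintype h] [Fintype ι] [Fintype κ]
    [DecidableEq r] [DecidableEq c] [DecidableEq e] [DecidableEq h] [DecidableEq ι] [DecidableEq κ]
    (M : Matrix r c F[X]) (H : Matrix r h F[X]) (K : Matrix e c F[X])
    (N : Matrix c κ F[X]) (N' : Matrix c e F[X]) (K' : Matrix κ c F[X])
    (G : Matrix ι r F[X]) (G' : Matrix h r F[X]) (H' : Matrix r ι F[X])
    (h1 : K * N' = 1) (h2 : K * N = 0) (h3 : K' * N' = 0) (h4 : K' * N = 1)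
    (g1 : G' * H = 1) (g2 : G * H = 0) (g3 : G' * H' = 0) (g4 : G * H' = 1)
    (s : ℕ) (hs : Fintype.card e + Fintype.card h = s)
    (hc : Fintype.card c = Fintype.card e + Fintype.card κ)
    (hr : Fintype.card r = Fintype.card h + Fintype.card ι) :
    IsLinearizationWith s (Matrix.fromBlocks M H K 0) (G * M * N) := by
  have es : e ⊕ h ≃ Fin s := Fintype.equivOfCardEq (by simp [hs])
  have er : r ⊕ e ≃ (e ⊕ h) ⊕ ι := Fintype.equivOfCardEq (by simp; omega)
  have ec : c ⊕ h ≃ (e ⊕ h) ⊕ κ := Fintype.equivOfCardEq (by simp; omega)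
  let U : Matrix ((e ⊕ h) ⊕ ι) (r ⊕ e) F[X] :=
    fromRows (fromRows (fromCols 0 1) (fromCols G' 0)) (fromCols G (-(G * M * N')))
  let U' : Matrix (r ⊕ e) ((e ⊕ h) ⊕ ι) F[X] :=
    fromRows (fromCols (fromCols (H' * (G * M * N')) H) H') (fromCols (fromCols 1 0) 0)
  let V : Matrix (c ⊕ h) ((e ⊕ h) ⊕ κ) F[X] :=
    fromRows (fromCols (fromCols N' 0) N)
      (fromCols (fromCols (-(G' * M * N')) 1) (-(G' * M * N)))
  let V' : Matrix ((e ⊕ h) ⊕ κ) (c ⊕ h) F[X] :=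
    fromRows (fromRows (fromCols K 0) (fromCols (G' * M) 1)) (fromCols K' 0)
  have hU : U * U' = 1 := by
    simp only [U, U', fromRows_mul, fromCols_mul_fromRows, mul_fromCols, Matrix.mul_zero, Matrix.zero_mul,
      Matrix.mul_one, Matrix.one_mul, ← Matrix.mul_assoc, g1, g2, g3, g4]
    ext ((i|i)|i) ((j|j)|j) <;> simp [Matrix.one_apply]
  have hV : V' * V = 1 := by
    simp only [V, V', fromRows_mul, fromCols_mul_fromRows, mul_fromCols, Matrix.mul_zero, Matrix.zero_mul,
      Matrix.mul_one, Matrix.one_mul, ← Matrix.mul_assoc, h1, h2, h3, h4]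
    ext ((i|i)|i) ((j|j)|j) <;> simp [Matrix.one_apply]
  have hL : U * fromBlocks M H K 0 * V = fromBlocks 1 0 0 (G * M * N) := by
    simp only [U, V, fromRows_mul, fromCols_mul_fromBlocks, fromCols_mul_fromRows, mul_fromCols, Matrix.mul_zero, Matrix.zero_mul,
      Matrix.mul_one, Matrix.one_mul, g1, g2, h1, h2, Matrix.add_mul, Matrix.mul_neg, Matrix.neg_mul, Matrix.mul_assoc]
    ext ((i|i)|i) ((j|j)|j) <;> simp [Matrix.one_apply]
  refine ⟨er.trans (es.sumCongr (Equiv.refl _)), ec.trans (es.sumCongr (Equiv.refl _)),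
    U.submatrix er id, V.submatrix id ec, ?_, ?_, ?_⟩
  · have : (U.submatrix er id) * (U'.submatrix id er) = 1 := by
      rw [← Matrix.submatrix_mul _ _ er id er Function.bijective_id, hU]; simp
    exact IsUnit.of_mul_eq_one _ (by rw [← det_mul, this, det_one])
  · have : (V'.submatrix ec id) * (V.submatrix id ec) = 1 := by
      rw [← Matrix.submatrix_mul _ _ ec id ec Function.bijective_id, hV]; simp
    exact IsUnit.of_mul_eq_one_right _ (by rw [← det_mul, this, det_one])
  · have : (U.submatrix er id) * fromBlocks M H K 0 * (V.submatrix id ec) =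
        (fromBlocks 1 0 0 (G * M * N) : Matrix ((e ⊕ h) ⊕ ι) ((e ⊕ h) ⊕ κ) F[X]).submatrix er ec := by
      rw [← hL]; rfl
    rw [this]
    ext (i|i) (j|j) <;> simp [Matrix.one_apply]

theorem Lk_mul_apply (F : Type*) [Field F] (k : ℕ) {p : Type*} (N : Matrix (Fin (k+1)) p F[X])
    (i : Fin k) (j : p) : (Lk F k * N) i j = - N i.castSucc j + X * N i.succ j := by
  rw [Matrix.mul_apply, Finset.sum_eq_add (i.castSucc) (i.succ)]
  · simp [Lk]
  · exact (Fin.castSucc_lt_succ).ne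
  · intro c _ hc
    have h1 : (c:ℕ) ≠ i := fun h => hc.1 (Fin.ext (by simpa using h))
    have h2 : (c:ℕ) ≠ i + 1 := fun h => hc.2 (Fin.ext (by simpa using h))
    simp [Lk, h1, h2]
  · simp
  · simp

theorem revLk_mul_apply (F : Type*) [Field F] (k : ℕ) {p : Type*} (N : Matrix (Fin (k+1)) p F[X])
    (i : Fin k) (j : p) : (revMat 1 (Lk F k) * N) i j = - X * N i.castSucc j + N i.succ j := by
  rw [Matrix.mul_apply, Finset.sum_eq_add (i.castSucc) (i.succ)]
  · have hx : reflect 1 (X : F[X]) = 1 := by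
      simpa using reflect_monomial (R := F) 1 1
    have ho : reflect 1 (1 : F[X]) = X := by
      simpa using reflect_one (R := F) 1
    simp [Lk, revMat, reflect_neg, hx, ho]
  · exact (Fin.castSucc_lt_succ).ne
  · intro c _ hc
    have h1 : (c:ℕ) ≠ i := fun h => hc.1 (Fin.ext (by simpa using h))
    have h2 : (c:ℕ) ≠ i + 1 := fun h => hc.2 (Fin.ext (by simpa using h))
    simp [Lk, revMat, h1, h2]
  · simp
  · simp

theorem compl_data (F : Type*) [Field F] (k : ℕ) :
    ∃ (N' : Matrix (Fin (k+1)) (Fin k) F[X]) (K' : Matrix (Fin 1) (Fin (k+1)) F[X]),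
      Lk F k * N' = 1 ∧ Lk F k * Lam F k = 0 ∧ K' * N' = 0 ∧ K' * Lam F k = 1 := by
  refine ⟨Matrix.of fun i j => if (i:ℕ) ≤ j then - X ^ ((j:ℕ) - i) else 0,
    Matrix.of fun _ j => if j = Fin.last k then 1 else 0, ?_, ?_, ?_, ?_⟩
  · ext1 i j
    rw [Lk_mul_apply]
    simp only [Matrix.of_apply, Fin.val_castSucc, Fin.val_succ, Matrix.one_apply, Fin.ext_iff]
    rcases lt_trichotomy (i:ℕ) j with h | h | h
    · rw [if_pos h.le, if_pos (by omega), if_neg h.ne,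
        show (j:ℕ) - i = (j - (i+1)) + 1 by omega, pow_succ]
      ring
    · simp [h]
    · rw [if_neg (by omega), if_neg (by omega), if_neg (by omega)]; simp
  · ext1 i j
    rw [Lk_mul_apply]
    simp only [Lam, Matrix.of_apply, Fin.val_castSucc, Fin.val_succ, Matrix.zero_apply]
    rw [show k - (i:ℕ) = (k - (i+1)) + 1 by omega, pow_succ]; ring
  · ext1 i j
    rw [Matrix.mul_apply]
    refine Finset.sum_eq_zero fun x _ => ?_
    by_cases hx : x = Fin.last k
    · subst hx
      have := j.2
      simp
    · simp [hx]
  · ext1 i j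
    simp [Matrix.mul_apply, Lam, Matrix.one_apply, Subsingleton.elim i j]

theorem revLam_apply (F : Type*) [Field F] (k : ℕ) (i j) :
    revMat k (Lam F k) i j = X ^ (i : ℕ) := by
  simp only [revMat, Lam, Matrix.of_apply]
  rw [← one_mul (X ^ _), ← C_1, reflect_C_mul_X_pow, revAt_le (by omega)]
  simp only [C_1, one_mul]
  congr 1; omega

theorem compl_data_rev (F : Type*) [Field F] (k : ℕ) :
    ∃ (N' : Matrix (Fin (k+1)) (Fin k) F[X]) (K' : Matrix (Fin 1) (Fin (k+1)) F[X]),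
      revMat 1 (Lk F k) * N' = 1 ∧ revMat 1 (Lk F k) * revMat k (Lam F k) = 0 ∧
      K' * N' = 0 ∧ K' * revMat k (Lam F k) = 1 := by
  refine ⟨Matrix.of fun i j => if (j:ℕ) < i then X ^ ((i:ℕ) - (j + 1)) else 0,
    Matrix.of fun _ j => if j = 0 then 1 else 0, ?_, ?_, ?_, ?_⟩
  · ext1 i j
    rw [revLk_mul_apply]
    simp only [Matrix.of_apply, Fin.val_castSucc, Fin.val_succ, Matrix.one_apply, Fin.ext_iff]
    rcases lt_trichotomy (i:ℕ) j with h | h | h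
    · rw [if_neg (by omega), if_neg (by omega), if_neg (by omega)]; simp
    · simp [h]
    · rw [if_pos h, if_pos (by omega), if_neg h.ne',
        show (i:ℕ) + 1 - (j + 1) = (i - (j+1)) + 1 by omega, pow_succ]
      ring
  · ext1 i j
    rw [revLk_mul_apply, revLam_apply, revLam_apply]
    simp only [Fin.val_castSucc, Fin.val_succ, Matrix.zero_apply, pow_succ]; ring
  · ext1 i j
    rw [Matrix.mul_apply]
    refine Finset.sum_eq_zero fun x _ => ?_
    by_cases hx : x = 0 <;> simp [hx]
  · ext1 i j
    simp [Matrix.mul_apply, revLam_apply, Matrix.one_apply, Subsingleton.elim i j]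

theorem lin_kron {F : Type*} [Field F] (ε n η m : ℕ)
    (M : Matrix (Fin (η + 1) × Fin m) (Fin (ε + 1) × Fin n) F[X])
    (A : Matrix (Fin ε) (Fin (ε+1)) F[X]) (a : Matrix (Fin (ε+1)) (Fin 1) F[X])
    (B : Matrix (Fin η) (Fin (η+1)) F[X]) (b : Matrix (Fin (η+1)) (Fin 1) F[X])
    (hA : ∃ (N' : Matrix (Fin (ε+1)) (Fin ε) F[X]) (K' : Matrix (Fin 1) (Fin (ε+1)) F[X]),
      A * N' = 1 ∧ A * a = 0 ∧ K' * N' = 0 ∧ K' * a = 1)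
    (hB : ∃ (N' : Matrix (Fin (η+1)) (Fin η) F[X]) (K' : Matrix (Fin 1) (Fin (η+1)) F[X]),
      B * N' = 1 ∧ B * b = 0 ∧ K' * N' = 0 ∧ K' * b = 1) :
    IsLinearizationWith (ε * n + η * m)
      (Matrix.fromBlocks M (Bᵀ ⊗ₖ (1 : Matrix (Fin m) (Fin m) F[X]))
        (A ⊗ₖ (1 : Matrix (Fin n) (Fin n) F[X])) 0)
      ((bᵀ ⊗ₖ (1 : Matrix (Fin m) (Fin m) F[X])) * M * (a ⊗ₖ (1 : Matrix (Fin n) (Fin n) F[X]))) := by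
  obtain ⟨N, K, h1, h2, h3, h4⟩ := hA
  obtain ⟨P, Q, g1, g2, g3, g4⟩ := hB
  apply lin_abstract (N' := N ⊗ₖ 1) (K' := K ⊗ₖ 1) (G' := Pᵀ ⊗ₖ 1) (H' := Qᵀ ⊗ₖ 1)
  any_goals simp only [← mul_kronecker_mul, ← transpose_mul, h1, h2, h3, h4, g1, g2, g3, g4,
    Matrix.one_mul, transpose_one, transpose_zero, one_kronecker_one, zero_kronecker]
  · simp
  · simp; ring
  · simp; ring

theorem revMat_mul {F : Type*} [Field F] {a b c : Type*} [Fintype b] (p q : ℕ)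
    (A : Matrix a b F[X]) (B : Matrix b c F[X])
    (hA : ∀ i j, (A i j).natDegree ≤ p) (hB : ∀ i j, (B i j).natDegree ≤ q) :
    revMat (p + q) (A * B) = revMat p A * revMat q B := by
  ext1 i j
  have hsum : ∀ (s : Finset b) (f : b → F[X]),
      reflect (p+q) (∑ x ∈ s, f x) = ∑ x ∈ s, reflect (p+q) (f x) := by
    intro s f
    classical
    induction s using Finset.induction_on with
    | empty => simp
    | insert x s hx ih => rw [Finset.sum_insert hx, Finset.sum_insert hx, reflect_add, ih]
  simp only [revMat, Matrix.of_apply, Matrix.mul_apply]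
  rw [hsum]
  exact Finset.sum_congr rfl fun x _ => reflect_mul _ _ (hA _ _) (hB _ _)

theorem revMat_kron {F : Type*} [Field F] {a b c : Type*} [DecidableEq c] (p : ℕ)
    (A : Matrix a b F[X]) :
    revMat p (A ⊗ₖ (1 : Matrix c c F[X])) = revMat p A ⊗ₖ (1 : Matrix c c F[X]) := by
  ext1 ⟨i, i'⟩ ⟨j, j'⟩
  by_cases h : i' = j' <;> simp [revMat, kroneckerMap_apply, Matrix.one_apply, h]

theorem kron_deg {F : Type*} [Field F] {a b c : Type*} [DecidableEq c] (p : ℕ)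
    (A : Matrix a b F[X]) (hA : ∀ i j, (A i j).natDegree ≤ p) (i j) :
    ((A ⊗ₖ (1 : Matrix c c F[X])) i j).natDegree ≤ p := by
  obtain ⟨i, i'⟩ := i
  obtain ⟨j, j'⟩ := j
  by_cases h : i' = j' <;> simp [kroneckerMap_apply, Matrix.one_apply, h, hA]

theorem Lam_deg (F : Type*) [Field F] (k : ℕ) (i j) : (Lam F k i j).natDegree ≤ k := by
  simp [Lam]

/-- Every `(ε,n,η,m)`-block Kronecker pencil is a strong linearization of
`Q(λ) = (Λ_η(λ)ᵀ⊗I_m)(λM₁+M₀)(Λ_ε(λ)⊗I_n)` regarded as a polynomial of grade `ε+η+1`: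
`U(λ)L(λ)V(λ) = diag(I_{εn+ηm}, Q(λ))` for unimodular `U, V`, and `rev_1 L(λ)` is a
linearization of `rev_{ε+η+1} Q(λ)`. -/
theorem statement_6 (F : Type*) [Field F] (ε n η m : ℕ) (hm : 1 ≤ m) (hn : 1 ≤ n)
    (M : Matrix (Fin (η + 1) × Fin m) (Fin (ε + 1) × Fin n) (Polynomial F))
    (hM : ∀ i j, (M i j).natDegree ≤ 1) :
    IsLinearizationWith (ε * n + η * m) (blockKron F ε n η m M) (QpolyOf F ε n η m M) ∧
    IsLinearization (revMat 1 (blockKron F ε n η m M))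
      (revMat (ε + η + 1) (QpolyOf F ε n η m M)) := by
  refine ⟨lin_kron ε n η m M _ _ _ _ (compl_data F ε) (compl_data F η), ε * n + η * m, ?_⟩
  have e1 : revMat 1 (blockKron F ε n η m M) = Matrix.fromBlocks (revMat 1 M)
      ((revMat 1 (Lk F η))ᵀ ⊗ₖ (1 : Matrix (Fin m) (Fin m) F[X]))
      (revMat 1 (Lk F ε) ⊗ₖ (1 : Matrix (Fin n) (Fin n) F[X])) 0 := by
    rw [← revMat_kron, show (revMat 1 (Lk F η))ᵀ = revMat 1 (Lk F η)ᵀ from rfl, ← revMat_kron]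
    ext1 (i|i) (j|j) <;> simp [revMat, blockKron]
  have e2 : revMat (ε + η + 1) (QpolyOf F ε n η m M) =
      ((revMat η (Lam F η))ᵀ ⊗ₖ (1 : Matrix (Fin m) (Fin m) F[X])) * revMat 1 M *
        (revMat ε (Lam F ε) ⊗ₖ (1 : Matrix (Fin n) (Fin n) F[X])) := by
    rw [← revMat_kron, show (revMat η (Lam F η))ᵀ = revMat η (Lam F η)ᵀ from rfl, ← revMat_kron]
    have d1 := kron_deg (c := Fin m) η (Lam F η)ᵀ (fun i j => Lam_deg F η j i)
    have d2 := kron_deg (c := Fin n) ε (Lam F ε) (Lam_deg F ε)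
    rw [← revMat_mul η 1 _ _ d1 hM, ← revMat_mul (η + 1) ε _ _ ?_ d2,
      show ε + η + 1 = η + 1 + ε by ring]
    · rfl
    · intro i j
      rw [Matrix.mul_apply]
      exact natDegree_sum_le_of_forall_le _ _ fun x _ =>
        natDegree_mul_le.trans (add_le_add (d1 _ _) (hM _ _))
  rw [e1, e2]
  exact lin_kron ε n η m _ _ _ _ _ (compl_data_rev F ε) (compl_data_rev F η)
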